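/- Fix d ≥ 1, T > 0, a compact interval Θ = [θ_min, θ_max] ⊂ (0,∞), a link function Φ, and a smooth ℤ^d-periodic initial value u_0. There exists a constant D > 0, depending only on d, T, Θ, Φ and u_0, such that: for every θ ∈ Θ, all continuous ℤ^d-periodic F, F₀ : ℝ^d → ℝ, and every continuous bounded ℤ^d-periodic h : ℝ^d → ℝ, if u_F, u_{F₀} are smooth classical solutions with absorptions Φ∘F, Φ∘F₀, diffusivity θ and initial value u_0, and z_F, z_{F₀} are the associated smooth linearized solutions in direction h, then ‖z_F − z_{F₀}‖_{L²(Q)} ≤ D ‖F − F₀‖_{L²(𝕋^d)} ‖h‖_∞. (Lemma 'bounds', item (ii): Lipschitz dependence of the linearization I_{θ,F}h on F.) -/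

import Mathlib

open MeasureTheory Real Filter

noncomputable section

/-- Partial derivative in the `i`-th spatial coordinate. -/
def pder {d : ℕ} (i : Fin d) (v : (Fin d → ℝ) → ℝ) : (Fin d → ℝ) → ℝ :=
  fun x => deriv (fun s => v (Function.update x i s)) (x i)

/-- Spatial Laplacian `Δ_x = ∑ᵢ ∂²/∂xᵢ²`. -/
def lap {d : ℕ} (v : (Fin d → ℝ) → ℝ) : (Fin d → ℝ) → ℝ :=
  fun x => ∑ i : Fin d, pder i (pder i v) x

/-- Multi-index spatial derivative `∂^j`. -/
def mder {d : ℕ} (j : Fin d → ℕ) (v : (Fin d → ℝ) → ℝ) : (Fin d → ℝ) → ℝ :=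
  (List.finRange d).foldr (fun i acc => (pder i)^[j i] acc) v

/-- `ℤ^d`-periodicity of a function on `ℝ^d`. -/
def ZPer {d : ℕ} (F : (Fin d → ℝ) → ℝ) : Prop :=
  ∀ (x : Fin d → ℝ) (k : Fin d → ℤ), F (fun i => x i + (k i : ℝ)) = F x

/-- `ℤ^d`-periodicity in the space variable. -/
def ZPerSpace {d : ℕ} (u : (Fin d → ℝ) → ℝ → ℝ) : Prop :=
  ∀ t : ℝ, ZPer fun x => u x t

/-- The fundamental domain `[0,1]^d` of the torus. -/
def unitCube (d : ℕ) : Set (Fin d → ℝ) := Set.Icc 0 1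

/-- `L²`-norm on the torus. -/
def l2T {d : ℕ} (F : (Fin d → ℝ) → ℝ) : ℝ :=
  Real.sqrt (∫ x in unitCube d, (F x) ^ 2)

/-- `L²`-norm on `Q = 𝕋^d × (0,T)`. -/
def l2Q {d : ℕ} (T : ℝ) (u : (Fin d → ℝ) → ℝ → ℝ) : ℝ :=
  Real.sqrt (∫ t in Set.Ioc (0 : ℝ) T, ∫ x in unitCube d, (u x t) ^ 2)

/-- Supremum norm over space. -/
def supT {d : ℕ} (F : (Fin d → ℝ) → ℝ) : ℝ := ⨆ x, |F x|

/-- Supremum norm over `𝕋^d × [0,T]`. -/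
def supQ {d : ℕ} (T : ℝ) (u : (Fin d → ℝ) → ℝ → ℝ) : ℝ :=
  ⨆ x, ⨆ t ∈ Set.Icc (0 : ℝ) T, |u x t|

/-- Squared Sobolev `H^β`-norm on the torus:  `∑_{|j| ≤ β} ‖∂^j F‖²_{L²(𝕋^d)}`. -/
def hSobSq {d : ℕ} (β : ℕ) (F : (Fin d → ℝ) → ℝ) : ℝ :=
  ∑ j ∈ Finset.univ.filter (fun j : Fin d → Fin (β + 1) => (∑ i, (j i : ℕ)) ≤ β),
    ∫ x in unitCube d, (mder (fun i => (j i : ℕ)) F x) ^ 2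

/-- Sobolev `H^β`-norm on the torus. -/
def hSob {d : ℕ} (β : ℕ) (F : (Fin d → ℝ) → ℝ) : ℝ := Real.sqrt (hSobSq β F)

/-- Squared parabolic Sobolev `H^{2,1}(Q)`-norm. -/
def h21Sq {d : ℕ} (T : ℝ) (u : (Fin d → ℝ) → ℝ → ℝ) : ℝ :=
  (∫ t in Set.Ioc (0 : ℝ) T,
      ∑ j ∈ Finset.univ.filter (fun j : Fin d → Fin 3 => (∑ i, (j i : ℕ)) ≤ 2),
        ∫ x in unitCube d, (mder (fun i => (j i : ℕ)) (fun y => u y t) x) ^ 2)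
    + ∫ x in unitCube d, ∫ t in Set.Ioc (0 : ℝ) T, ((u x t) ^ 2 + (deriv (u x) t) ^ 2)

/-- Parabolic Sobolev `H^{2,1}(Q)`-norm. -/
def h21 {d : ℕ} (T : ℝ) (u : (Fin d → ℝ) → ℝ → ℝ) : ℝ := Real.sqrt (h21Sq T u)

/-- Smoothness of a function of space and time. -/
def SmoothQ {d : ℕ} (u : (Fin d → ℝ) → ℝ → ℝ) : Prop :=
  ContDiff ℝ (⊤ : ℕ∞) fun p : (Fin d → ℝ) × ℝ => u p.1 p.2

/-- A smooth classical solution of the heat equation with absorption `f`,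
diffusivity `θ` and initial value `u0`. -/
def HeatSol {d : ℕ} (T θ : ℝ) (f u0 : (Fin d → ℝ) → ℝ) (u : (Fin d → ℝ) → ℝ → ℝ) : Prop :=
  SmoothQ u ∧ ZPerSpace u ∧
    (∀ (x : Fin d → ℝ), ∀ t ∈ Set.Ioc (0 : ℝ) T,
      deriv (u x) t = θ / 2 * lap (fun y => u y t) x - f x * u x t) ∧
    ∀ x, u x 0 = u0 x

/-- A smooth solution of the inhomogeneous problem with forcing `g` and
zero initial value (`v = 𝓛_{θ,f}⁻¹ g`). -/
def InhomSol {d : ℕ} (T θ : ℝ) (f : (Fin d → ℝ) → ℝ) (g v : (Fin d → ℝ) → ℝ → ℝ) : Prop :=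
  SmoothQ v ∧ ZPerSpace v ∧
    (∀ (x : Fin d → ℝ), ∀ t ∈ Set.Ioc (0 : ℝ) T,
      deriv (v x) t = θ / 2 * lap (fun y => v y t) x - f x * v x t + g x t) ∧
    ∀ x, v x 0 = 0

/-- A link function: a smooth function `Φ : ℝ → (fmin, ∞)` with strictly positive
derivative and all derivatives bounded. -/
structure LinkFun where
  toFun : ℝ → ℝ
  fmin : ℝ
  fmin_pos : 0 < fmin
  smooth : ContDiff ℝ (⊤ : ℕ∞) toFun
  gt_fmin : ∀ x, fmin < toFun x
  deriv_pos : ∀ x, 0 < deriv toFun x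
  derivs_bdd : ∀ n : ℕ, 1 ≤ n → ∃ C, ∀ x, |iteratedDeriv n toFun x| ≤ C

/-- The linearized solution `I_{θ,F} h` in direction `h`, associated with a solution `u`. -/
def LinSol {d : ℕ} (T θ : ℝ) (Φ : LinkFun) (F h : (Fin d → ℝ) → ℝ)
    (u z : (Fin d → ℝ) → ℝ → ℝ) : Prop :=
  SmoothQ z ∧ ZPerSpace z ∧
    (∀ (x : Fin d → ℝ), ∀ t ∈ Set.Ioc (0 : ℝ) T,
      deriv (z x) t = θ / 2 * lap (fun y => z y t) x - Φ.toFun (F x) * z x t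
        + h x * deriv Φ.toFun (F x) * u x t) ∧
    ∀ x, z x 0 = 0

/-- The `θ`-derivative solution `K̇_θ F`, associated with a solution `u`. -/
def ThetaDerivSol {d : ℕ} (T θ : ℝ) (Φ : LinkFun) (F : (Fin d → ℝ) → ℝ)
    (u w : (Fin d → ℝ) → ℝ → ℝ) : Prop :=
  SmoothQ w ∧ ZPerSpace w ∧
    (∀ (x : Fin d → ℝ), ∀ t ∈ Set.Ioc (0 : ℝ) T,
      deriv (w x) t = θ / 2 * lap (fun y => w y t) x - Φ.toFun (F x) * w x t
        + 1 / 2 * lap (fun y => u y t) x) ∧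
    ∀ x, w x 0 = 0

/-- Dual Sobolev norm `‖G‖_{(H²)*}` on the torus. -/
def h2dual {d : ℕ} (G : (Fin d → ℝ) → ℝ) : ℝ :=
  sSup {r : ℝ | ∃ g : (Fin d → ℝ) → ℝ, ContDiff ℝ (⊤ : ℕ∞) g ∧ ZPer g ∧ hSob 2 g ≤ 1 ∧
    r = |∫ x in unitCube d, G x * g x|}

end

theorem exists_unitCube_eq {d : ℕ} (x : Fin d → ℝ) :
    ∃ y ∈ unitCube d, ∀ φ : (Fin d → ℝ) → ℝ, ZPer φ → φ x = φ y := by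
  refine ⟨fun i => Int.fract (x i), ⟨fun i => Int.fract_nonneg _, fun i => (Int.fract_lt_one _).le⟩,
    fun φ hφ => ?_⟩
  rw [← hφ x fun i => -⌊x i⌋]
  congr 1
  funext i
  simp [Int.fract, sub_eq_add_neg]

theorem isCompact_unitCube (d : ℕ) : IsCompact (unitCube d) := isCompact_Icc

theorem integrableOn_unitCube {d : ℕ} {φ : (Fin d → ℝ) → ℝ} (hφ : Continuous φ) :
    IntegrableOn φ (unitCube d) :=
  hφ.continuousOn.integrableOn_compact (isCompact_unitCube d)

theorem hasDerivAt_comp_update {d : ℕ} {v : (Fin d → ℝ) → ℝ} (hv : Differentiable ℝ v)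
    (x : Fin d → ℝ) (i : Fin d) (s : ℝ) :
    HasDerivAt (fun s => v (Function.update x i s))
      (fderiv ℝ v (Function.update x i s) (Pi.single i 1)) s :=
  (hv _).hasFDerivAt.comp_hasDerivAt s (hasDerivAt_update x i s)

theorem pder_eq_fderiv {d : ℕ} {v : (Fin d → ℝ) → ℝ} (hv : Differentiable ℝ v) (i : Fin d) :
    pder i v = fun x => fderiv ℝ v x (Pi.single i 1) := by
  funext x
  simpa [pder] using (hasDerivAt_comp_update hv x i (x i)).deriv

theorem contDiff_pder {d : ℕ} {v : (Fin d → ℝ) → ℝ} (hv : ContDiff ℝ (⊤ : ℕ∞) v) (i : Fin d) :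
    ContDiff ℝ (⊤ : ℕ∞) (pder i v) := by
  rw [pder_eq_fderiv (hv.differentiable (by simp))]
  exact (hv.fderiv_right (m := (⊤ : ℕ∞)) (by simp)).clm_apply contDiff_const

theorem continuous_lap {d : ℕ} {v : (Fin d → ℝ) → ℝ} (hv : ContDiff ℝ (⊤ : ℕ∞) v) :
    Continuous (lap v) :=
  continuous_finsetSum _ fun i _ => (contDiff_pder (contDiff_pder hv i) i).continuous

theorem pder_sub {d : ℕ} {v w : (Fin d → ℝ) → ℝ} (hv : Differentiable ℝ v)
    (hw : Differentiable ℝ w) (i : Fin d) :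
    pder i (fun x => v x - w x) = fun x => pder i v x - pder i w x := by
  rw [pder_eq_fderiv hv, pder_eq_fderiv hw, pder_eq_fderiv (hv.fun_sub hw)]
  funext x
  rw [fderiv_fun_sub (hv x) (hw x)]
  rfl

theorem pder_neg {d : ℕ} (v : (Fin d → ℝ) → ℝ) (i : Fin d) :
    pder i (fun x => - v x) = fun x => - pder i v x := by
  funext x
  exact deriv.fun_neg

theorem lap_neg {d : ℕ} (v : (Fin d → ℝ) → ℝ) (x : Fin d → ℝ) :
    lap (fun x => - v x) x = - lap v x := by
  simp [lap, pder_neg]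

theorem lap_sub {d : ℕ} {v w : (Fin d → ℝ) → ℝ} (hv : ContDiff ℝ (⊤ : ℕ∞) v)
    (hw : ContDiff ℝ (⊤ : ℕ∞) w) (x : Fin d → ℝ) :
    lap (fun x => v x - w x) x = lap v x - lap w x := by
  have hd : ∀ {φ : (Fin d → ℝ) → ℝ}, ContDiff ℝ (⊤ : ℕ∞) φ → Differentiable ℝ φ :=
    fun h => h.differentiable (by simp)
  simp only [lap, ← Finset.sum_sub_distrib]
  refine Finset.sum_congr rfl fun i _ => ?_
  rw [pder_sub (hd hv) (hd hw), pder_sub (hd (contDiff_pder hv i)) (hd (contDiff_pder hw i))]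

theorem deriv_deriv_nonpos_of_isMax {φ : ℝ → ℝ} (hφ : ContDiff ℝ 2 φ) {a : ℝ}
    (hmax : ∀ s, φ s ≤ φ a) : deriv (deriv φ) a ≤ 0 := by
  by_contra! hpos
  have hloc : IsLocalMax φ a := Eventually.of_forall hmax
  have hmin := isLocalMin_of_deriv_deriv_pos hpos hloc.deriv_eq_zero hφ.continuous.continuousAt
  have hc : φ =ᶠ[nhds a] fun _ => φ a := by
    filter_upwards [hmin] with s hs using le_antisymm (hmax s) hs
  have := hc.deriv.deriv_eq
  simp at this
  linarith

theorem lap_nonpos_of_isMax {d : ℕ} {v : (Fin d → ℝ) → ℝ} (hv : ContDiff ℝ (⊤ : ℕ∞) v)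
    {x : Fin d → ℝ} (hmax : ∀ y, v y ≤ v x) : lap v x ≤ 0 := by
  refine Finset.sum_nonpos fun i _ => ?_
  have h : pder i (pder i v) x = deriv (deriv fun s => v (Function.update x i s)) (x i) := by
    simp only [pder, Function.update_idem, Function.update_self]
  rw [h]
  refine deriv_deriv_nonpos_of_isMax ?_ fun s => by simpa using hmax _
  exact (contDiff_infty.1 hv 2).comp (contDiff_update 2 x i)

theorem SmoothQ.space {d : ℕ} {v : (Fin d → ℝ) → ℝ → ℝ} (hv : SmoothQ v) (t : ℝ) :
    ContDiff ℝ (⊤ : ℕ∞) fun x => v x t :=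
  ContDiff.comp (g := fun p : (Fin d → ℝ) × ℝ => v p.1 p.2) hv
    (contDiff_id.prodMk contDiff_const)

theorem SmoothQ.time {d : ℕ} {v : (Fin d → ℝ) → ℝ → ℝ} (hv : SmoothQ v) (x : Fin d → ℝ) :
    ContDiff ℝ (⊤ : ℕ∞) (v x) :=
  ContDiff.comp (g := fun p : (Fin d → ℝ) × ℝ => v p.1 p.2) hv
    (contDiff_const.prodMk contDiff_id)

theorem SmoothQ.hasDerivAt {d : ℕ} {v : (Fin d → ℝ) → ℝ → ℝ} (hv : SmoothQ v)
    (x : Fin d → ℝ) (t : ℝ) : HasDerivAt (v x) (deriv (v x) t) t :=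
  ((hv.time x).differentiable (by simp) t).hasDerivAt

theorem SmoothQ.sub {d : ℕ} {v w : (Fin d → ℝ) → ℝ → ℝ} (hv : SmoothQ v) (hw : SmoothQ w) :
    SmoothQ fun x t => v x t - w x t :=
  ContDiff.sub hv hw

theorem ZPerSpace.sub {d : ℕ} {v w : (Fin d → ℝ) → ℝ → ℝ} (hv : ZPerSpace v) (hw : ZPerSpace w) :
    ZPerSpace fun x t => v x t - w x t := fun t x k => by
  have h1 := hv t x k
  have h2 := hw t x k
  simp only at h1 h2 ⊢
  rw [h1, h2]

theorem SmoothQ.continuous_deriv {d : ℕ} {v : (Fin d → ℝ) → ℝ → ℝ} (hv : SmoothQ v) :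
    Continuous fun p : (Fin d → ℝ) × ℝ => deriv (v p.1) p.2 := by
  have h : (fun p : (Fin d → ℝ) × ℝ => deriv (v p.1) p.2) =
      fun p => fderiv ℝ (fun p : (Fin d → ℝ) × ℝ => v p.1 p.2) p (0, 1) := by
    funext p
    have h1 := (ContDiff.differentiable hv (by simp) p).hasFDerivAt
    exact (h1.comp_hasDerivAt p.2 ((hasDerivAt_const p.2 p.1).prodMk (hasDerivAt_id p.2))).deriv
  rw [h]
  exact (ContDiff.continuous_fderiv hv (by simp)).clm_apply continuous_const

/-- Weak maximum principle for bounded sources. -/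
theorem le_of_heat_subsolution {d : ℕ} {T θ M K : ℝ} (hθ : 0 < θ) (hM : 0 ≤ M) (hK : 0 ≤ K)
    {f : (Fin d → ℝ) → ℝ} (hf : ∀ x, 0 ≤ f x) {v : (Fin d → ℝ) → ℝ → ℝ} (hv : SmoothQ v)
    (hper : ZPerSpace v) (h0 : ∀ x, v x 0 ≤ M)
    (heq : ∀ x, ∀ t ∈ Set.Ioc (0 : ℝ) T,
      deriv (v x) t ≤ θ / 2 * lap (fun y => v y t) x - f x * v x t + K)
    {t : ℝ} (ht : t ∈ Set.Icc 0 T) (x : Fin d → ℝ) : v x t ≤ M + K * t := by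
  refine le_of_forall_pos_le_add fun ε hε => ?_
  have hT : 0 ≤ T := ht.1.trans ht.2
  set c : ℝ := ε / (1 + T) with hc
  have hcpos : 0 < c := by positivity
  obtain ⟨⟨y, s⟩, ⟨hy, hs⟩, hmax⟩ := ((isCompact_unitCube d).prod
    (isCompact_Icc (a := (0 : ℝ)) (b := T))).exists_isMaxOn
    ⟨(0, 0), ⟨⟨le_rfl, zero_le_one⟩, ⟨le_rfl, hT⟩⟩⟩
    (f := fun p => v p.1 p.2 - M - K * p.2 - c * (1 + p.2))
    (by have := ContDiff.continuous hv; fun_prop)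
  have hmax' : ∀ x, ∀ r ∈ Set.Icc 0 T,
      v x r - M - K * r - c * (1 + r) ≤ v y s - M - K * s - c * (1 + s) := by
    intro x r hr
    obtain ⟨x', hx', hxx'⟩ := exists_unitCube_eq x
    rw [hxx' _ (hper r)]
    exact hmax (a := (x', r)) ⟨hx', hr⟩
  have hneg : v y s - M - K * s - c * (1 + s) ≤ 0 := by
    by_contra! hpos
    have hs0 : 0 < s := by
      rcases hs.1.eq_or_lt with h | h
      · subst h
        have := h0 y
        nlinarith
      · exact h
    have hlap : lap (fun z => v z s) y ≤ 0 :=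
      lap_nonpos_of_isMax (hv.space s) fun z => by linarith [hmax' z s hs]
    have hder : HasDerivAt (fun r => v y r - M - K * r - c * (1 + r)) (deriv (v y) s - K - c) s := by
      have h1 := (((hv.hasDerivAt y s).sub_const M).sub ((hasDerivAt_id s).const_mul K)).sub
        (((hasDerivAt_id s).const_add 1).const_mul c)
      rw [mul_one, mul_one] at h1
      exact h1
    have hge : 0 ≤ deriv (v y) s - K - c := by
      have htend := (hasDerivAt_iff_tendsto_slope.1 hder).mono_left
        (nhdsWithin_mono s (fun r (hr : r ∈ Set.Iio s) => hr.ne))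
      refine ge_of_tendsto htend ?_
      filter_upwards [Ioo_mem_nhdsLT hs0] with r hr
      rw [slope_def_field]
      exact div_nonneg_of_nonpos (by linarith [hmax' y r ⟨hr.1.le, hr.2.le.trans hs.2⟩])
        (by linarith [hr.2])
    have h2 := heq y s ⟨hs0, hs.2⟩
    have hvpos : 0 ≤ v y s := by nlinarith [mul_nonneg hK hs.1, mul_nonneg hcpos.le hs.1]
    nlinarith [mul_nonneg (hf y) hvpos]
  have h3 := hmax' x t ht
  have h4 : c * (1 + t) ≤ ε := by
    rw [hc, div_mul_eq_mul_div, div_le_iff₀ (by positivity)]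
    nlinarith [ht.2]
  linarith

theorem abs_le_of_heat_eq {d : ℕ} {T θ M K : ℝ} (hθ : 0 < θ) (hM : 0 ≤ M) (hK : 0 ≤ K)
    {f : (Fin d → ℝ) → ℝ} (hf : ∀ x, 0 ≤ f x) {v g : (Fin d → ℝ) → ℝ → ℝ} (hv : SmoothQ v)
    (hper : ZPerSpace v) (h0 : ∀ x, |v x 0| ≤ M)
    (hg : ∀ x, ∀ t ∈ Set.Ioc (0 : ℝ) T, |g x t| ≤ K)
    (heq : ∀ x, ∀ t ∈ Set.Ioc (0 : ℝ) T,
      deriv (v x) t = θ / 2 * lap (fun y => v y t) x - f x * v x t + g x t)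
    {t : ℝ} (ht : t ∈ Set.Icc 0 T) (x : Fin d → ℝ) : |v x t| ≤ M + K * t := by
  refine abs_le'.2 ⟨?_, ?_⟩
  · exact le_of_heat_subsolution hθ hM hK hf hv hper (fun x => (abs_le.1 (h0 x)).2)
      (fun x t ht => by linarith [heq x t ht, (abs_le.1 (hg x t ht)).2]) ht x
  · refine le_of_heat_subsolution (v := fun x t => - v x t) hθ hM hK hf (ContDiff.neg hv)
      (fun t x k => congrArg Neg.neg (hper t x k)) (fun x => by linarith [(abs_le.1 (h0 x)).1])
      (fun x t ht => ?_) ht x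
    rw [lap_neg, deriv.fun_neg]
    linarith [heq x t ht, (abs_le.1 (hg x t ht)).1]

theorem ZPer.pder {d : ℕ} {v : (Fin d → ℝ) → ℝ} (hv : ZPer v) (i : Fin d) : ZPer (pder i v) := by
  intro x k
  have h : ∀ s, v (Function.update (fun j => x j + (k j : ℝ)) i (s + k i)) =
      v (Function.update x i s) := by
    intro s
    rw [← hv (Function.update x i s) k]
    congr 1
    funext j
    rcases eq_or_ne j i with rfl | hj
    · simp
    · simp [hj]
  simp only [_root_.pder, ← h]
  exact (deriv_comp_add_const
    (fun s => v (Function.update (fun j => x j + (k j : ℝ)) i s)) (k i : ℝ) (x i)).symm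

theorem ZPer.mul {d : ℕ} {v w : (Fin d → ℝ) → ℝ} (hv : ZPer v) (hw : ZPer w) :
    ZPer fun x => v x * w x := fun x k => by
  simp only [hv x k, hw x k]

/-- The integral of the divergence of a periodic field over the unit cube vanishes. -/
theorem integral_sum_pder_eq_zero {d : ℕ} {φ : Fin d → (Fin d → ℝ) → ℝ}
    (hφ : ∀ i, ContDiff ℝ (⊤ : ℕ∞) (φ i)) (hper : ∀ i, ZPer (φ i)) :
    ∫ x in unitCube d, ∑ i, pder i (φ i) x = 0 := by
  cases d with
  | zero => simp
  | succ n =>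
    have hd : ∀ i, Differentiable ℝ (φ i) := fun i => (hφ i).differentiable (by simp)
    have hcont : Continuous fun x => ∑ i, pder i (φ i) x :=
      continuous_finsetSum _ fun i _ => (contDiff_pder (hφ i) i).continuous
    have hint := integrableOn_unitCube hcont
    simp only [fun i => pder_eq_fderiv (hd i) i] at hint ⊢
    rw [unitCube, integral_divergence_of_hasFDerivAt_off_countable' (0 : Fin (n + 1) → ℝ) 1
      zero_le_one φ (fun i x => fderiv ℝ (φ i) x) ∅ Set.countable_empty
      (fun i => (hφ i).continuous.continuousOn) (fun x _ i => (hd i x).hasFDerivAt) hint]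
    refine Finset.sum_eq_zero fun i _ => sub_eq_zero.2 ?_
    congr 1
    funext y
    rw [← hper i (i.insertNth ((0 : Fin (n + 1) → ℝ) i) y) (Pi.single i 1)]
    congr 1
    funext j
    rcases eq_or_ne j i with rfl | hj
    · simp
    · obtain ⟨l, rfl⟩ := Fin.exists_succAbove_eq hj
      simp

theorem integral_mul_lap_nonpos {d : ℕ} {v : (Fin d → ℝ) → ℝ} (hv : ContDiff ℝ (⊤ : ℕ∞) v)
    (hper : ZPer v) : ∫ x in unitCube d, v x * lap v x ≤ 0 := by
  have hdv : Differentiable ℝ v := hv.differentiable (by simp)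
  have hprod : ∀ (i : Fin d) (x : Fin d → ℝ),
      pder i (fun x => v x * pder i v x) x = pder i v x ^ 2 + v x * pder i (pder i v) x := by
    intro i x
    have hdp : Differentiable ℝ (pder i v) := (contDiff_pder hv i).differentiable (by simp)
    have h1 : ∀ w : (Fin d → ℝ) → ℝ, Differentiable ℝ w →
        DifferentiableAt ℝ (fun s => w (Function.update x i s)) (x i) :=
      fun w hw => (hasDerivAt_comp_update hw x i (x i)).differentiableAt
    have h2 := deriv_fun_mul (h1 v hdv) (h1 _ hdp)
    rw [Function.update_eq_self] at h2
    calc pder i (fun x => v x * pder i v x) x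
        = pder i v x * pder i v x + v x * pder i (pder i v) x := h2
      _ = _ := by ring
  have hzero := integral_sum_pder_eq_zero (φ := fun i x => v x * pder i v x)
    (fun i => hv.mul (contDiff_pder hv i)) (fun i => hper.mul (hper.pder i))
  have hsq : Continuous fun x => ∑ i, pder i v x ^ 2 :=
    continuous_finsetSum _ fun i _ => (contDiff_pder hv i).continuous.pow 2
  have hsum : ∀ x, ∑ i, pder i (fun x => v x * pder i v x) x =
      ∑ i, pder i v x ^ 2 + v x * lap v x := by
    intro x
    simp only [hprod, lap, Finset.sum_add_distrib, Finset.mul_sum]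
  simp only [hsum] at hzero
  have hvl : Continuous fun x => v x * lap v x := hv.continuous.mul (continuous_lap hv)
  rw [integral_add (integrableOn_unitCube hsq) (integrableOn_unitCube hvl)] at hzero
  have : 0 ≤ ∫ x in unitCube d, ∑ i, pder i v x ^ 2 :=
    integral_nonneg fun x => Finset.sum_nonneg fun i _ => sq_nonneg _
  linarith

theorem SmoothQ.hasDerivAt_integral_sq {d : ℕ} {v : (Fin d → ℝ) → ℝ → ℝ} (hv : SmoothQ v)
    (t : ℝ) : HasDerivAt (fun t => ∫ x in unitCube d, v x t ^ 2)
      (∫ x in unitCube d, 2 * v x t * deriv (v x) t) t := by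
  have hcv : Continuous fun p : (Fin d → ℝ) × ℝ => v p.1 p.2 := ContDiff.continuous hv
  have hc : Continuous fun p : (Fin d → ℝ) × ℝ => 2 * v p.1 p.2 * deriv (v p.1) p.2 :=
    (continuous_const.mul hcv).mul hv.continuous_deriv
  obtain ⟨C, hC⟩ := ((isCompact_unitCube d).prod
    (isCompact_Icc (a := t - 1) (b := t + 1))).exists_bound_of_continuousOn hc.continuousOn
  have hslice : ∀ s, Continuous fun x : Fin d → ℝ => v x s ^ 2 := fun s =>
    (hv.space s).continuous.pow 2
  refine (hasDerivAt_integral_of_dominated_loc_of_deriv_le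
    (F := fun t x => v x t ^ 2) (F' := fun t x => 2 * v x t * deriv (v x) t) (bound := fun _ => C)
    (Icc_mem_nhds (by linarith : t - 1 < t) (by linarith : t < t + 1))
    (Eventually.of_forall fun s => (hslice s).aestronglyMeasurable)
    (integrableOn_unitCube (hslice t))
    (hc.comp (Continuous.prodMk_left t)).aestronglyMeasurable ?_
    (integrableOn_unitCube continuous_const) ?_).2
  · refine (ae_restrict_iff' (isCompact_unitCube d).measurableSet).2
      (Eventually.of_forall fun x hx s hs => hC (x, s) ⟨hx, hs⟩)
  · refine Eventually.of_forall fun x s _ => ?_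
    simpa using (hv.hasDerivAt x s).fun_pow 2

/-- Energy estimate for the heat equation with strictly positive absorption, zero initial value
and a source bounded in `L²` uniformly in time. -/
theorem integral_sq_le_of_heat_eq {d : ℕ} {T θ m B : ℝ} (hθ : 0 < θ) (hm : 0 < m)
    {f : (Fin d → ℝ) → ℝ} (hf : ∀ x, m ≤ f x)
    {v g : (Fin d → ℝ) → ℝ → ℝ} (hv : SmoothQ v) (hper : ZPerSpace v) (h0 : ∀ x, v x 0 = 0)
    (hgc : ∀ t, Continuous fun x => g x t)
    (hg : ∀ t ∈ Set.Ioc (0 : ℝ) T, ∫ x in unitCube d, g x t ^ 2 ≤ B) (hB : 0 ≤ B)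
    (heq : ∀ x, ∀ t ∈ Set.Ioc (0 : ℝ) T,
      deriv (v x) t = θ / 2 * lap (fun y => v y t) x - f x * v x t + g x t)
    {t : ℝ} (ht : t ∈ Set.Icc 0 T) : ∫ x in unitCube d, v x t ^ 2 ≤ T * (B / (2 * m)) := by
  have hE := hv.hasDerivAt_integral_sq
  have hder : ∀ s ∈ interior (Set.Icc (0 : ℝ) T),
      deriv (fun t => ∫ x in unitCube d, v x t ^ 2) s ≤ B / (2 * m) := by
    intro s hs
    rw [interior_Icc] at hs
    have hs' : s ∈ Set.Ioc 0 T := ⟨hs.1, hs.2.le⟩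
    have hvc := (hv.space s).continuous
    have hlc := continuous_lap (hv.space s)
    have hvl : Continuous fun x => v x s * lap (fun y => v y s) x := hvc.mul hlc
    have hg2 : Continuous fun x => g x s ^ 2 := (hgc s).pow 2
    have hθvl : Continuous fun x => θ * (v x s * lap (fun y => v y s) x) :=
      continuous_const.mul hvl
    rw [(hE s).deriv]
    calc ∫ x in unitCube d, 2 * v x s * deriv (v x) s
        ≤ ∫ x in unitCube d, (θ * (v x s * lap (fun y => v y s) x) + g x s ^ 2 / (2 * m)) := by
          refine integral_mono (integrableOn_unitCube ?_) (integrableOn_unitCube ?_) fun x => ?_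
          · exact (continuous_const.mul hvc).mul (hv.continuous_deriv.comp
              (Continuous.prodMk_left s))
          · exact hθvl.add (hg2.div_const _)
          · simp only [heq x s hs']
            have h1 : 2 * v x s * g x s ≤ 2 * m * v x s ^ 2 + g x s ^ 2 / (2 * m) := by
              have : 2 * m * v x s ^ 2 + g x s ^ 2 / (2 * m) - 2 * v x s * g x s =
                  (2 * m * v x s - g x s) ^ 2 / (2 * m) := by field_simp; ring
              have h3 : 0 ≤ (2 * m * v x s - g x s) ^ 2 / (2 * m) := by positivity
              linarith
            nlinarith [mul_le_mul_of_nonneg_right (hf x) (sq_nonneg (v x s))]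
      _ = θ * (∫ x in unitCube d, v x s * lap (fun y => v y s) x)
            + (∫ x in unitCube d, g x s ^ 2) / (2 * m) := by
          rw [integral_add (integrableOn_unitCube hθvl)
            (integrableOn_unitCube (hg2.div_const _)), integral_const_mul, integral_div]
      _ ≤ 0 + B / (2 * m) := by
          refine add_le_add (mul_nonpos_of_nonneg_of_nonpos hθ.le
            (integral_mul_lap_nonpos (hv.space s) (hper s))) ?_
          exact div_le_div_of_nonneg_right (hg s hs') (by positivity)
      _ = B / (2 * m) := zero_add _
  have hmv := (convex_Icc (0 : ℝ) T).image_sub_le_mul_sub_of_deriv_le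
    (fun s _ => (hE s).continuousAt.continuousWithinAt)
    (fun s _ => (hE s).differentiableAt.differentiableWithinAt) hder 0
    ⟨le_rfl, ht.1.trans ht.2⟩ t ht ht.1
  simp only [h0] at hmv
  have : B / (2 * m) * (t - 0) ≤ T * (B / (2 * m)) := by
    rw [sub_zero, mul_comm]
    exact mul_le_mul_of_nonneg_right ht.2 (by positivity)
  simp at hmv
  linarith

theorem LinkFun.continuous (Φ : LinkFun) : Continuous Φ.toFun := Φ.smooth.continuous

theorem LinkFun.continuous_deriv (Φ : LinkFun) : Continuous (deriv Φ.toFun) :=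
  Φ.smooth.continuous_deriv (by simp)

theorem abs_sub_le_of_abs_deriv_le {φ : ℝ → ℝ} {C : ℝ} (hφ : Differentiable ℝ φ)
    (hC : ∀ x, |deriv φ x| ≤ C) (a b : ℝ) : |φ a - φ b| ≤ C * |a - b| :=
  Convex.norm_image_sub_le_of_norm_deriv_le (fun x _ => hφ x) (fun x _ => hC x) convex_univ
    (Set.mem_univ b) (Set.mem_univ a)

theorem LinkFun.exists_bounds (Φ : LinkFun) : ∃ C₁ C₂ : ℝ, 0 ≤ C₁ ∧ 0 ≤ C₂ ∧
    (∀ a, |deriv Φ.toFun a| ≤ C₁) ∧ (∀ a b, |Φ.toFun a - Φ.toFun b| ≤ C₁ * |a - b|) ∧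
    ∀ a b, |deriv Φ.toFun a - deriv Φ.toFun b| ≤ C₂ * |a - b| := by
  obtain ⟨C₁, h₁⟩ := Φ.derivs_bdd 1 le_rfl
  obtain ⟨C₂, h₂⟩ := Φ.derivs_bdd 2 one_le_two
  simp only [iteratedDeriv_succ, iteratedDeriv_zero] at h₁ h₂
  have hd : ContDiff ℝ 1 (deriv Φ.toFun) :=
    (contDiff_succ_iff_deriv.1 ((contDiff_infty.1 Φ.smooth 2 : ContDiff ℝ (1 + 1) Φ.toFun))).2.2
  exact ⟨C₁, C₂, (abs_nonneg _).trans (h₁ 0), (abs_nonneg _).trans (h₂ 0), h₁,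
    abs_sub_le_of_abs_deriv_le (Φ.smooth.differentiable (by simp)) h₁,
    abs_sub_le_of_abs_deriv_le (hd.differentiable (by simp)) h₂⟩

theorem ZPer.exists_bound {d : ℕ} {φ : (Fin d → ℝ) → ℝ} (hper : ZPer φ) (hφ : Continuous φ) :
    ∃ M, 0 ≤ M ∧ ∀ x, |φ x| ≤ M := by
  obtain ⟨M, hM⟩ := (isCompact_unitCube d).exists_bound_of_continuousOn hφ.continuousOn
  have h : ∀ x, |φ x| ≤ M := fun x => by
    obtain ⟨y, hy, hxy⟩ := exists_unitCube_eq x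
    rw [hxy φ hper]
    exact hM y hy
  exact ⟨M, (abs_nonneg _).trans (h 0), h⟩

/-- Lipschitz dependence of the linearization `I_{θ,F} h` on `F`
(Lemma `bounds`, item (ii)). -/
theorem linearization_lipschitz_in_F {d : ℕ} (hd : 1 ≤ d) (T θmin θmax : ℝ)
    (hT : 0 < T) (hθmin : 0 < θmin) (hθ : θmin ≤ θmax) (Φ : LinkFun)
    (u0 : (Fin d → ℝ) → ℝ) (hu0 : ContDiff ℝ (⊤ : ℕ∞) u0) (hu0per : ZPer u0) :
    ∃ D > (0 : ℝ), ∀ θ ∈ Set.Icc θmin θmax,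
      ∀ F F₀ h : (Fin d → ℝ) → ℝ, Continuous F → ZPer F → Continuous F₀ → ZPer F₀ →
      Continuous h → (∃ M, ∀ x, |h x| ≤ M) → ZPer h →
      ∀ uF uF₀ zF zF₀ : (Fin d → ℝ) → ℝ → ℝ,
        HeatSol T θ (fun x => Φ.toFun (F x)) u0 uF →
        HeatSol T θ (fun x => Φ.toFun (F₀ x)) u0 uF₀ →
        LinSol T θ Φ F h uF zF →
        LinSol T θ Φ F₀ h uF₀ zF₀ →
        l2Q T (fun x t => zF x t - zF₀ x t)
          ≤ D * l2T (fun x => F x - F₀ x) * supT h := by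
  obtain ⟨M, hM0, hM⟩ := hu0per.exists_bound hu0.continuous
  obtain ⟨C₁, C₂, hC₁, hC₂, hΦ', hΦ, hΦ'L⟩ := Φ.exists_bounds
  have hm := Φ.fmin_pos
  set m := Φ.fmin
  have hfm : ∀ a, m ≤ Φ.toFun a := fun a => (Φ.gt_fmin a).le
  have hf0 : ∀ a, 0 ≤ Φ.toFun a := fun a => hm.le.trans (hfm a)
  set a := C₁ * (T * (C₁ * M)) + C₂ * M with ha
  have ha0 : 0 ≤ a := by positivity
  set A := 2 * a ^ 2 + 2 * C₁ ^ 2 * (T * ((C₁ * M) ^ 2 / (2 * m))) with hA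
  have hA0 : 0 ≤ A := by positivity
  refine ⟨√(T * (T * (A / (2 * m)))) + 1, by positivity, ?_⟩
  intro θ hθ' F F₀ h hF _ hF₀ _ hh hhb _ U U₀ z z₀ hU hU₀ hz hz₀
  have hθ0 : 0 < θ := hθmin.trans_le hθ'.1
  set H := supT h with hH
  have hHb : ∀ x, |h x| ≤ H := by
    obtain ⟨B, hB⟩ := hhb
    exact fun x => le_ciSup (f := fun x => |h x|) ⟨B, by rintro _ ⟨y, rfl⟩; exact hB y⟩ x
  have hH0 : 0 ≤ H := (abs_nonneg _).trans (hHb 0)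
  have hUb : ∀ {f : (Fin d → ℝ) → ℝ} {u : (Fin d → ℝ) → ℝ → ℝ}, (∀ x, 0 ≤ f x) →
      HeatSol T θ f u0 u → ∀ t ∈ Set.Icc 0 T, ∀ x, |u x t| ≤ M := by
    rintro f u hf ⟨h1, h2, h3, h4⟩ t ht x
    simpa using abs_le_of_heat_eq (g := fun _ _ => 0) hθ0 hM0 le_rfl hf h1 h2
      (fun x => by simpa [h4 x] using hM x) (fun _ _ _ => by simp)
      (fun x t ht => by rw [h3 x t ht, add_zero]) ht x
  have hUM := hUb (fun x => hf0 (F x)) hU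
  have hU₀M := hUb (fun x => hf0 (F₀ x)) hU₀
  obtain ⟨hUs, hUp, hUe, hUi⟩ := hU
  obtain ⟨hU₀s, hU₀p, hU₀e, hU₀i⟩ := hU₀
  obtain ⟨hzs, hzp, hze, hzi⟩ := hz
  obtain ⟨hz₀s, hz₀p, hz₀e, hz₀i⟩ := hz₀
  have hz₀b : ∀ t ∈ Set.Ioc 0 T, ∀ x, |z₀ x t| ≤ T * (H * C₁ * M) := by
    intro t ht x
    have h1 := abs_le_of_heat_eq (M := 0) (K := H * C₁ * M) hθ0 le_rfl (by positivity)
      (fun x => hf0 (F₀ x)) hz₀s hz₀p (fun x => by simp [hz₀i x])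
      (fun x t ht => by
        rw [abs_mul, abs_mul]
        gcongr
        exacts [hHb x, hΦ' _, hU₀M t (Set.Ioc_subset_Icc_self ht) x])
      hz₀e (Set.Ioc_subset_Icc_self ht) x
    have h2 : H * C₁ * M * t ≤ H * C₁ * M * T :=
      mul_le_mul_of_nonneg_left ht.2 (by positivity)
    linarith
  set S := ∫ x in unitCube d, (F x - F₀ x) ^ 2 with hS
  have hS0 : 0 ≤ S := integral_nonneg fun x => sq_nonneg _
  have hδ : Continuous fun x => (F x - F₀ x) ^ 2 := (hF.sub hF₀).pow 2
  have hV : ∀ t ∈ Set.Icc 0 T, ∫ x in unitCube d, (U x t - U₀ x t) ^ 2 ≤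
      T * ((C₁ * M) ^ 2 * S / (2 * m)) := by
    intro t ht
    refine integral_sq_le_of_heat_eq
      (g := fun x t => -((Φ.toFun (F x) - Φ.toFun (F₀ x)) * U₀ x t)) hθ0 hm
      (fun x => hfm (F x)) (hUs.sub hU₀s) (hUp.sub hU₀p) (fun x => by simp [hUi, hU₀i])
      (fun t => (((Φ.continuous.comp hF).sub (Φ.continuous.comp hF₀)).mul
        (hU₀s.space t).continuous).neg) (fun t ht => ?_) (by positivity) (fun x t ht => ?_) ht
    · rw [hS, ← integral_const_mul]
      refine integral_mono (integrableOn_unitCube (((((Φ.continuous.comp hF).sub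
        (Φ.continuous.comp hF₀)).mul (hU₀s.space t).continuous).neg).pow 2))
        (integrableOn_unitCube (continuous_const.mul hδ)) fun x => ?_
      have h1 : |(Φ.toFun (F x) - Φ.toFun (F₀ x)) * U₀ x t| ≤ C₁ * |F x - F₀ x| * M := by
        rw [abs_mul]
        gcongr
        exacts [hΦ _ _, hU₀M t (Set.Ioc_subset_Icc_self ht) x]
      calc (-((Φ.toFun (F x) - Φ.toFun (F₀ x)) * U₀ x t)) ^ 2
          = |(Φ.toFun (F x) - Φ.toFun (F₀ x)) * U₀ x t| ^ 2 := by rw [neg_sq, sq_abs]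
        _ ≤ (C₁ * |F x - F₀ x| * M) ^ 2 := by gcongr
        _ = (C₁ * M) ^ 2 * (F x - F₀ x) ^ 2 := by rw [← sq_abs (F x - F₀ x)]; ring
    · rw [deriv_fun_sub (hUs.hasDerivAt x t).differentiableAt
        (hU₀s.hasDerivAt x t).differentiableAt, lap_sub (hUs.space t) (hU₀s.space t),
        hUe x t ht, hU₀e x t ht]
      ring
  have hW : ∀ t ∈ Set.Icc 0 T, ∫ x in unitCube d, (z x t - z₀ x t) ^ 2 ≤
      T * (H ^ 2 * A * S / (2 * m)) := by
    intro t ht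
    have hgc : ∀ t, Continuous fun x => -((Φ.toFun (F x) - Φ.toFun (F₀ x)) * z₀ x t) +
        h x * ((deriv Φ.toFun (F x) - deriv Φ.toFun (F₀ x)) * U₀ x t +
          deriv Φ.toFun (F x) * (U x t - U₀ x t)) := by
      intro t
      have h1 := Φ.continuous
      have h2 := Φ.continuous_deriv
      have h3 := (hz₀s.space t).continuous
      have h4 := (hU₀s.space t).continuous
      have h5 := (hUs.space t).continuous
      fun_prop
    refine integral_sq_le_of_heat_eq
      (g := fun x t => -((Φ.toFun (F x) - Φ.toFun (F₀ x)) * z₀ x t) +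
        h x * ((deriv Φ.toFun (F x) - deriv Φ.toFun (F₀ x)) * U₀ x t +
          deriv Φ.toFun (F x) * (U x t - U₀ x t))) hθ0 hm
      (fun x => hfm (F x)) (hzs.sub hz₀s) (hzp.sub hz₀p) (fun x => by simp [hzi, hz₀i])
      hgc (fun t ht => ?_) (by positivity) (fun x t ht => ?_) ht
    · have ht' := Set.Ioc_subset_Icc_self ht
      have hv2 : Continuous fun x => (U x t - U₀ x t) ^ 2 :=
        ((hUs.space t).continuous.sub (hU₀s.space t).continuous).pow 2
      have hi1 : Continuous fun x => H ^ 2 * (2 * a ^ 2) * (F x - F₀ x) ^ 2 :=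
        continuous_const.mul hδ
      have hi2 : Continuous fun x => H ^ 2 * (2 * C₁ ^ 2) * (U x t - U₀ x t) ^ 2 :=
        continuous_const.mul hv2
      calc _ ≤ ∫ x in unitCube d, (H ^ 2 * (2 * a ^ 2) * (F x - F₀ x) ^ 2 +
            H ^ 2 * (2 * C₁ ^ 2) * (U x t - U₀ x t) ^ 2) := by
            refine integral_mono (integrableOn_unitCube ((hgc t).pow 2))
              (integrableOn_unitCube (hi1.add hi2)) fun x => ?_
            have h1 : |-((Φ.toFun (F x) - Φ.toFun (F₀ x)) * z₀ x t) +
                h x * ((deriv Φ.toFun (F x) - deriv Φ.toFun (F₀ x)) * U₀ x t +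
                  deriv Φ.toFun (F x) * (U x t - U₀ x t))| ≤
                C₁ * |F x - F₀ x| * (T * (H * C₁ * M)) +
                  H * (C₂ * |F x - F₀ x| * M + C₁ * |U x t - U₀ x t|) := by
              refine (abs_add_le _ _).trans ?_
              rw [abs_neg, abs_mul, abs_mul (h x)]
              refine add_le_add (mul_le_mul (hΦ _ _) (hz₀b t ht x) (abs_nonneg _)
                (by positivity)) (mul_le_mul (hHb x) ?_ (abs_nonneg _) hH0)
              refine (abs_add_le _ _).trans ?_
              rw [abs_mul, abs_mul]
              gcongr
              exacts [hΦ'L _ _, hU₀M t ht' x, hΦ' _]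
            have h2 : C₁ * |F x - F₀ x| * (T * (H * C₁ * M)) +
                  H * (C₂ * |F x - F₀ x| * M + C₁ * |U x t - U₀ x t|) =
                H * (a * |F x - F₀ x| + C₁ * |U x t - U₀ x t|) := by rw [ha]; ring
            rw [h2] at h1
            have h3 := pow_le_pow_left₀ (abs_nonneg _) h1 2
            rw [sq_abs] at h3
            refine h3.trans ?_
            rw [mul_pow, ← sq_abs (F x - F₀ x), ← sq_abs (U x t - U₀ x t)]
            have h4 := add_sq_le (a := a * |F x - F₀ x|) (b := C₁ * |U x t - U₀ x t|)
            have h5 := mul_le_mul_of_nonneg_left h4 (sq_nonneg H)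
            linarith
        _ = H ^ 2 * (2 * a ^ 2) * S +
            H ^ 2 * (2 * C₁ ^ 2) * ∫ x in unitCube d, (U x t - U₀ x t) ^ 2 := by
            rw [integral_add (integrableOn_unitCube hi1) (integrableOn_unitCube hi2),
              integral_const_mul, integral_const_mul]
        _ ≤ H ^ 2 * (2 * a ^ 2) * S +
            H ^ 2 * (2 * C₁ ^ 2) * (T * ((C₁ * M) ^ 2 * S / (2 * m))) := by
            gcongr
            exact hV t ht'
        _ = H ^ 2 * A * S := by rw [hA]; ring
    · rw [deriv_fun_sub (hzs.hasDerivAt x t).differentiableAt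
        (hz₀s.hasDerivAt x t).differentiableAt, lap_sub (hzs.space t) (hz₀s.space t),
        hze x t ht, hz₀e x t ht]
      ring
  have htotal : ∫ t in Set.Ioc (0 : ℝ) T, ∫ x in unitCube d, (z x t - z₀ x t) ^ 2 ≤
      T * (T * (A / (2 * m))) * S * H ^ 2 := by
    have h1 := norm_setIntegral_le_of_norm_le_const (μ := volume) (s := Set.Ioc (0 : ℝ) T)
      (f := fun t => ∫ x in unitCube d, (z x t - z₀ x t) ^ 2)
      (C := T * (H ^ 2 * A * S / (2 * m))) measure_Ioc_lt_top (fun t ht => by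
        rw [Real.norm_of_nonneg (integral_nonneg fun x => sq_nonneg _)]
        exact hW t (Set.Ioc_subset_Icc_self ht))
    rw [Real.volume_real_Ioc_of_le hT.le, sub_zero] at h1
    calc _ ≤ _ := (le_abs_self _).trans h1
      _ = _ := by ring
  calc l2Q T (fun x t => z x t - z₀ x t)
      ≤ √(T * (T * (A / (2 * m))) * S * H ^ 2) := Real.sqrt_le_sqrt htotal
    _ = √(T * (T * (A / (2 * m)))) * l2T (fun x => F x - F₀ x) * H := by
        rw [Real.sqrt_mul (by positivity), Real.sqrt_mul (by positivity), Real.sqrt_sq hH0]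
        rfl
    _ ≤ (√(T * (T * (A / (2 * m)))) + 1) * l2T (fun x => F x - F₀ x) * H := by
        have : 0 ≤ l2T fun x => F x - F₀ x := Real.sqrt_nonneg _
        gcongr
        linarith
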